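/- Let p > 2 and k > 0. There is no function v ∈ C²([-k, +∞)) satisfying -v''(r) = v(r)^{p-1} for all r ∈ (-k, +∞), v(-k) = 0, 0 ≤ v(r) ≤ 1 for all r ∈ [-k, +∞), and v(0) = 1. -/

import Mathlib

open Set Filter Topology

/-- Lemma 2.4, half-line case: for `p > 2` and `k > 0` there is
no `v ∈ C²([-k,∞))` with `-v'' = v^(p-1)` on `(-k,∞)`, `v(-k) = 0`,
`0 ≤ v ≤ 1` on `[-k,∞)`, and `v 0 = 1`. -/
theorem stmt8 (p : ℝ) (hp : 2 < p) (k : ℝ) (hk : 0 < k) :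
    ¬ ∃ v : ℝ → ℝ, ContDiffOn ℝ 2 v (Ici (-k)) ∧
      (∀ r ∈ Ioi (-k), -(deriv (deriv v) r) = v r ^ (p - 1)) ∧
      v (-k) = 0 ∧ (∀ r ∈ Ici (-k), 0 ≤ v r ∧ v r ≤ 1) ∧ v 0 = 1 := by
  rintro ⟨v, hv, hode, -, hb, h0⟩
  have hv1 : ContDiffOn ℝ 2 v (Ioi (-k)) := hv.mono Ioi_subset_Ici_self
  have hd1 : DifferentiableOn ℝ v (Ioi (-k)) := hv1.differentiableOn (by norm_num)
  have hd2 : DifferentiableOn ℝ (deriv v) (Ioi (-k)) :=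
    (hv1.deriv_of_isOpen (m := 1) isOpen_Ioi (by norm_num)).differentiableOn (by norm_num)
  have h0k : (0 : ℝ) ∈ Ioi (-k) := by simpa using hk
  have hmax : IsLocalMax v 0 := by
    filter_upwards [isOpen_Ioi.mem_nhds h0k] with r hr
    rw [h0]
    exact (hb r (Ioi_subset_Ici_self hr)).2
  have hv0 : deriv v 0 = 0 := hmax.deriv_eq_zero
  have hanti : AntitoneOn (deriv v) (Ioi (-k)) := by
    apply antitoneOn_of_deriv_nonpos (convex_Ioi _) hd2.continuousOn
    · simpa using hd2
    · intro x hx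
      rw [interior_Ioi] at hx
      have h1 := hode x hx
      have h2 := Real.rpow_nonneg (hb x (Ioi_subset_Ici_self hx)).1 (p - 1)
      linarith
  have hdd : HasDerivAt (deriv v) (-1) 0 := by
    have h1 := (hd2.differentiableAt (isOpen_Ioi.mem_nhds h0k)).hasDerivAt
    have h2 := hode 0 h0k
    rw [h0, Real.one_rpow] at h2
    have h3 : deriv (deriv v) 0 = -1 := by linarith
    rwa [h3] at h1
  obtain ⟨r, hr0, hr⟩ : ∃ r : ℝ, 0 < r ∧ deriv v r < 0 := by
    have h1 := (hasDerivAt_iff_tendsto_slope.1 hdd).eventually_lt_const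
      (show (-1 : ℝ) < 0 by norm_num)
    have h2 : ∀ᶠ x in 𝓝[>] (0 : ℝ), slope (deriv v) 0 x < 0 :=
      h1.filter_mono (nhdsWithin_mono _ (fun x hx => ne_of_gt hx))
    obtain ⟨x, hx, hx0⟩ := (h2.and self_mem_nhdsWithin).exists
    have hx0' : 0 < x := hx0
    refine ⟨x, hx0', ?_⟩
    rw [slope_def_field, hv0, sub_zero, sub_zero] at hx
    by_contra hc
    exact absurd (div_nonneg (not_lt.1 hc) hx0'.le) (not_le.2 hx)
  have hsub : Ici r ⊆ Ioi (-k) := fun x hx => by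
    have : r ≤ x := hx
    show -k < x
    linarith
  have hlin := (convex_Ici r).image_sub_le_mul_sub_of_deriv_le (hd1.mono hsub).continuousOn
    (hd1.mono (interior_subset.trans hsub)) (C := deriv v r)
    (fun x hx => hanti (hsub self_mem_Ici) (hsub (interior_subset hx)) (interior_subset hx))
  have hpos : 0 < 2 / (-deriv v r) := div_pos two_pos (by linarith)
  have hmem : r + 2 / (-deriv v r) ∈ Ici r := by
    show r ≤ _
    linarith
  have h1 := hlin r self_mem_Ici _ hmem hmem
  have h2 : deriv v r * (r + 2 / (-deriv v r) - r) = -2 := by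
    field_simp [hr.ne]
    ring
  have h3 := (hb _ (Ioi_subset_Ici_self (hsub hmem))).1
  have h4 := (hb r (Ioi_subset_Ici_self (hsub self_mem_Ici))).2
  linarith
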